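/- Let φ(x,y) be a convex function on ℝ^n × ℝ^m such that e^{−φ(x,·)} is integrable on ℝ^m for each x. Define φ̃(x) = −log ∫_{ℝ^m} e^{−φ(x,y)} dy. Then φ̃ is a convex function on ℝ^n (Prékopa's theorem). -/

import Mathlib

open MeasureTheory
open scoped ENNReal

/-- One-dimensional Brunn-Minkowski inequality for compact sets. -/
lemma bm_compact {a b : ℝ} (ha : 0 < a) (hb : 0 < b) {K L C : Set ℝ}
    (hK : IsCompact K) (hL : IsCompact L) (hK0 : K.Nonempty) (hL0 : L.Nonempty)
    (hC : ∀ x ∈ K, ∀ y ∈ L, a * x + b * y ∈ C) :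
    ENNReal.ofReal a * volume K + ENNReal.ofReal b * volume L ≤ volume C := by
  obtain ⟨k, hkK, hk⟩ := hK.exists_isGreatest hK0
  obtain ⟨l, hlL, hl⟩ := hL.exists_isLeast hL0
  have key : ∀ (c d : ℝ), 0 < c → ∀ S : Set ℝ, 
      volume ((fun x => c * x + d) '' S) = ENNReal.ofReal c * volume S := by
    intro c d hc S
    have : (fun x => c * x + d) '' S = (fun x => x + d) '' ((fun x => c * x) '' S) := by
      rw [Set.image_image]
    rw [this, Set.image_add_right, measure_preimage_add_right]
    have := Measure.addHaar_smul (volume : Measure ℝ) c S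
    rw [Module.finrank_self, pow_one, abs_of_pos hc] at this
    rw [← this]
    rfl
  set A := (fun x => a * x + b * l) '' K
  set B := (fun y => b * y + a * k) '' L
  have hA : volume A = _ := key a (b * l) ha K
  have hB : volume B = _ := key b (a * k) hb L
  have hBm : MeasurableSet B := (hL.image (by fun_prop)).isClosed.measurableSet
  rw [← hA, ← hB]
  have hdis : AEDisjoint volume A B := by
    refine measure_mono_null (t := {a * k + b * l}) ?_ (by simp)
    rintro z ⟨⟨x, hx, rfl⟩, ⟨y, hy, hxy⟩⟩
    have h1 := mul_le_mul_of_nonneg_left (hk hx) ha.le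
    have h2 := mul_le_mul_of_nonneg_left (hl hy) hb.le
    simp only [Set.mem_singleton_iff] at *
    linarith
  rw [← measure_union₀ hBm.nullMeasurableSet hdis]
  refine measure_mono ?_
  rintro z (⟨x, hx, rfl⟩ | ⟨y, hy, rfl⟩)
  · exact hC x hx l hlL
  · have := hC k hkK y hy
    rwa [add_comm] at this

/-- One-dimensional Brunn-Minkowski inequality. -/
lemma bm_meas {a b : ℝ} (ha : 0 < a) (hb : 0 < b) {A B C : Set ℝ}
    (hA : MeasurableSet A) (hB : MeasurableSet B) (hA0 : A.Nonempty) (hB0 : B.Nonempty)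
    (hC : ∀ x ∈ A, ∀ y ∈ B, a * x + b * y ∈ C) :
    ENNReal.ofReal a * volume A + ENNReal.ofReal b * volume B ≤ volume C := by
  obtain ⟨x0, hx0⟩ := hA0
  obtain ⟨y0, hy0⟩ := hB0
  rw [hA.measure_eq_iSup_isCompact, hB.measure_eq_iSup_isCompact]
  simp only [ENNReal.mul_iSup, iSup_and']
  refine ENNReal.biSup_add_biSup_le' ⟨∅, by simp⟩ ⟨∅, by simp⟩ ?_
  rintro K ⟨hKA, hK⟩ L ⟨hLB, hL⟩
  refine le_trans ?_ (bm_compact ha hb (hK.insert x0) (hL.insert y0) ⟨x0, by simp⟩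
    ⟨y0, by simp⟩ (C := C) ?_)
  · gcongr <;> exact Set.subset_insert _ _
  · intro x hx y hy
    exact hC x (Set.insert_subset hx0 hKA hx) y (Set.insert_subset hy0 hLB hy)

lemma layer_norm {a b : ℝ} (ha : 0 < a) (hb : 0 < b) {f g h : ℝ → ℝ}
    (hf : Measurable f) (hg : Measurable g) (hh : Measurable h)
    (hf0 : ∀ x, 0 ≤ f x) (hg0 : ∀ x, 0 ≤ g x) (hh0 : ∀ x, 0 ≤ h x)
    (hf1 : ∀ x, f x ≤ 1) (hg1 : ∀ x, g x ≤ 1)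
    (hf2 : ∀ s < 1, ∃ x, s < f x) (hg2 : ∀ s < 1, ∃ x, s < g x)
    (H : ∀ s, 0 < s → ∀ x y, s < f x → s < g y → s < h (a * x + b * y)) :
    (ENNReal.ofReal a * ∫⁻ x, ENNReal.ofReal (f x)) +
      ENNReal.ofReal b * ∫⁻ x, ENNReal.ofReal (g x) ≤ ∫⁻ x, ENNReal.ofReal (h x) := by
  rw [lintegral_eq_lintegral_meas_lt volume (.of_forall hf0) hf.aemeasurable,
    lintegral_eq_lintegral_meas_lt volume (.of_forall hg0) hg.aemeasurable,
    lintegral_eq_lintegral_meas_lt volume (.of_forall hh0) hh.aemeasurable,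
    ← lintegral_const_mul' _ _ ENNReal.ofReal_ne_top,
    ← lintegral_const_mul' _ _ ENNReal.ofReal_ne_top, ← lintegral_add_left']
  · refine setLIntegral_mono' measurableSet_Ioi ?_
    intro s hs
    by_cases h1 : s < 1
    · refine bm_meas ha hb (measurableSet_lt measurable_const hf)
        (measurableSet_lt measurable_const hg) (hf2 s h1) (hg2 s h1) ?_
      intro x hx y hy
      exact H s hs x y hx hy
    · have e1 : {x | s < f x} = ∅ := by
        ext x; simpa using (hf1 x).trans (not_lt.1 h1)
      have e2 : {x | s < g x} = ∅ := by
        ext x; simpa using (hg1 x).trans (not_lt.1 h1)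
      simp [e1, e2]
  · have : Antitone fun s => volume {x | s < f x} := by
      intro s t hst
      exact measure_mono fun x hx => lt_of_le_of_lt hst hx
    exact (this.measurable.const_mul _).aemeasurable

lemma amgm_ennreal {a b : ℝ} (ha : 0 < a) (hb : 0 < b) (hab : a + b = 1) (p q : ℝ≥0∞) :
    p ^ a * q ^ b ≤ ENNReal.ofReal a * p + ENNReal.ofReal b * q := by
  have hc : (a⁻¹).HolderConjugate b⁻¹ :=
    ⟨by simpa using hab, by positivity, by positivity⟩
  have := ENNReal.young_inequality (p ^ a) (q ^ b) hc
  rw [← ENNReal.rpow_mul, ← ENNReal.rpow_mul, mul_inv_cancel₀ ha.ne', mul_inv_cancel₀ hb.ne',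
    ENNReal.rpow_one, ENNReal.rpow_one, ENNReal.ofReal_inv_of_pos ha,
    ENNReal.ofReal_inv_of_pos hb, div_eq_mul_inv, div_eq_mul_inv, inv_inv, inv_inv] at this
  rwa [mul_comm p, mul_comm q] at this

/-- Prékopa-Leindler on the line, functions with supremum one. -/
lemma pl_norm {a b : ℝ} (ha : 0 < a) (hb : 0 < b) (hab : a + b = 1) {f g h : ℝ → ℝ≥0∞}
    (hf : Measurable f) (hg : Measurable g) (hh : Measurable h)
    (hf1 : ⨆ x, f x = 1) (hg1 : ⨆ x, g x = 1)
    (H : ∀ x y, f x ^ a * g y ^ b ≤ h (a * x + b * y)) :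
    (∫⁻ x, f x) ^ a * (∫⁻ x, g x) ^ b ≤ ∫⁻ x, h x := by
  have lef : ∀ x, f x ≤ 1 := fun x => hf1 ▸ le_iSup f x
  have leg : ∀ x, g x ≤ 1 := fun x => hg1 ▸ le_iSup g x
  have tf : ∀ x, f x ≠ ∞ := fun x => ((lef x).trans_lt ENNReal.one_lt_top).ne
  have tg : ∀ x, g x ≠ ∞ := fun x => ((leg x).trans_lt ENNReal.one_lt_top).ne
  have th : ∀ x, min (h x) 1 ≠ ∞ := fun x => ((min_le_right _ _).trans_lt ENNReal.one_lt_top).ne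
  have ex : ∀ u : ℝ → ℝ≥0∞, (∀ x, u x ≠ ∞) → ⨆ x, u x = 1 → ∀ s < (1 : ℝ), ∃ x, s < (u x).toReal := by
    intro u hu h1 s hs
    have : ENNReal.ofReal s < ⨆ x, u x := by
      rw [h1]; simpa using hs
    obtain ⟨x, hx⟩ := lt_iSup_iff.1 this
    refine ⟨x, ?_⟩
    by_contra! hc
    refine absurd hx (not_lt.2 ?_)
    rw [← ENNReal.ofReal_toReal (hu x)]
    exact ENNReal.ofReal_le_ofReal hc
  have key := layer_norm ha hb (f := fun x => (f x).toReal) (g := fun x => (g x).toReal)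
    (h := fun x => (min (h x) 1).toReal) hf.ennreal_toReal hg.ennreal_toReal
    (hh.min measurable_const).ennreal_toReal (fun _ => ENNReal.toReal_nonneg)
    (fun _ => ENNReal.toReal_nonneg) (fun _ => ENNReal.toReal_nonneg)
    (fun x => ENNReal.toReal_le_of_le_ofReal zero_le_one (by simpa using lef x))
    (fun x => ENNReal.toReal_le_of_le_ofReal zero_le_one (by simpa using leg x))
    (ex f tf hf1) (ex g tg hg1) (by
      intro s hs x y hx hy
      rw [← ENNReal.ofReal_lt_iff_lt_toReal hs.le (tf x)] at hx
      rw [← ENNReal.ofReal_lt_iff_lt_toReal hs.le (tg y)] at hy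
      rw [← ENNReal.ofReal_lt_iff_lt_toReal hs.le (th _)]
      refine lt_min ?_ (hx.trans_le (lef x))
      refine lt_of_lt_of_le ?_ (H x y)
      have h0 : ENNReal.ofReal s ≠ 0 := by simpa using hs
      calc ENNReal.ofReal s = ENNReal.ofReal s ^ a * ENNReal.ofReal s ^ b := by
            rw [← ENNReal.rpow_add _ _ h0 ENNReal.ofReal_ne_top, hab, ENNReal.rpow_one]
        _ < _ := ENNReal.mul_lt_mul (ENNReal.rpow_lt_rpow hx ha) (ENNReal.rpow_lt_rpow hy hb))
  simp only [ENNReal.ofReal_toReal, tf, tg, th, ne_eq, not_false_eq_true] at key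
  exact (amgm_ennreal ha hb hab _ _).trans (key.trans (lintegral_mono fun x => min_le_left _ _))

/-- Prékopa-Leindler on the line, bounded functions. -/
lemma pl_bdd {a b : ℝ} (ha : 0 < a) (hb : 0 < b) (hab : a + b = 1) {f g h : ℝ → ℝ≥0∞}
    (hf : Measurable f) (hg : Measurable g) (hh : Measurable h)
    (hf1 : ⨆ x, f x ≠ ∞) (hg1 : ⨆ x, g x ≠ ∞)
    (H : ∀ x y, f x ^ a * g y ^ b ≤ h (a * x + b * y)) :
    (∫⁻ x, f x) ^ a * (∫⁻ x, g x) ^ b ≤ ∫⁻ x, h x := by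
  by_cases hf0 : ⨆ x, f x = 0
  · have : ∀ x, f x = 0 := by simpa using hf0
    simp [this, ha]
  by_cases hg0 : ⨆ x, g x = 0
  · have : ∀ x, g x = 0 := by simpa using hg0
    simp [this, hb]
  set M := ⨆ x, f x with hM
  set L := ⨆ x, g x with hL
  have hM' : M⁻¹ ≠ ∞ := by simpa using hf0
  have hL' : L⁻¹ ≠ ∞ := by simpa using hg0
  have key := pl_norm ha hb hab (f := fun x => M⁻¹ * f x) (g := fun x => L⁻¹ * g x)
    (h := fun x => (M⁻¹ ^ a * L⁻¹ ^ b) * h x) (hf.const_mul _) (hg.const_mul _) (hh.const_mul _)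
    (by rw [← ENNReal.mul_iSup, ← hM, ENNReal.inv_mul_cancel hf0 hf1])
    (by rw [← ENNReal.mul_iSup, ← hL, ENNReal.inv_mul_cancel hg0 hg1])
    (by
      intro x y
      rw [ENNReal.mul_rpow_of_nonneg _ _ ha.le, ENNReal.mul_rpow_of_nonneg _ _ hb.le,
        mul_mul_mul_comm]
      gcongr
      exact H x y)
  have c0 : M⁻¹ ^ a * L⁻¹ ^ b ≠ 0 := by
    simp [ENNReal.rpow_eq_zero_iff, hf1, hg1, hf0, hg0, ha.not_gt, hb.not_gt]
  have ct : M⁻¹ ^ a * L⁻¹ ^ b ≠ ∞ :=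
    ENNReal.mul_ne_top (ENNReal.rpow_ne_top_of_nonneg ha.le hM')
      (ENNReal.rpow_ne_top_of_nonneg hb.le hL')
  rw [lintegral_const_mul' _ _ hM', lintegral_const_mul' _ _ hL', lintegral_const_mul' _ _ ct,
    ENNReal.mul_rpow_of_nonneg _ _ ha.le, ENNReal.mul_rpow_of_nonneg _ _ hb.le,
    mul_mul_mul_comm] at key
  exact (ENNReal.mul_le_mul_iff_right c0 ct).1 key

lemma trunc_tendsto {f : ℝ → ℝ≥0∞} (hf : Measurable f) :
    Filter.Tendsto (fun n : ℕ => ∫⁻ x, min (f x) n) Filter.atTop (nhds (∫⁻ x, f x)) := by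
  refine lintegral_tendsto_of_tendsto_of_monotone
    (fun n => (hf.min measurable_const).aemeasurable) (.of_forall fun x => ?_)
    (.of_forall fun x => ?_)
  · intro i j hij
    exact min_le_min le_rfl (by exact_mod_cast hij)
  · have := (tendsto_const_nhds (x := f x) (f := Filter.atTop)).min
      ENNReal.tendsto_nat_nhds_top
    simpa using this

/-- Prékopa-Leindler on the line. -/
lemma pl_one {a b : ℝ} (ha : 0 < a) (hb : 0 < b) (hab : a + b = 1) {f g h : ℝ → ℝ≥0∞}
    (hf : Measurable f) (hg : Measurable g) (hh : Measurable h)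
    (H : ∀ x y, f x ^ a * g y ^ b ≤ h (a * x + b * y)) :
    (∫⁻ x, f x) ^ a * (∫⁻ x, g x) ^ b ≤ ∫⁻ x, h x := by
  by_cases hf0 : ∫⁻ x, f x = 0
  · simp [hf0, ha]
  by_cases hg0 : ∫⁻ x, g x = 0
  · simp [hg0, hb]
  have t1 := (ENNReal.continuous_rpow_const (y := a)).tendsto _ |>.comp (trunc_tendsto hf)
  have t2 := (ENNReal.continuous_rpow_const (y := b)).tendsto _ |>.comp (trunc_tendsto hg)
  refine le_of_tendsto (ENNReal.Tendsto.mul t1 (.inl ?_) t2 (.inl ?_)) (.of_forall fun n => ?_)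
  · simp [ENNReal.rpow_eq_zero_iff, hf0, ha.not_gt]
  · simp [ENNReal.rpow_eq_zero_iff, hg0, hb.not_gt]
  · have bd : ∀ u : ℝ → ℝ≥0∞, ⨆ x, min (u x) (n : ℝ≥0∞) ≠ ∞ := fun u =>
      ((iSup_le fun x => min_le_right _ _).trans_lt (ENNReal.natCast_lt_top n)).ne
    refine pl_bdd ha hb hab (hf.min measurable_const) (hg.min measurable_const) hh (bd f) (bd g) ?_
    intro x y
    refine le_trans ?_ (H x y)
    gcongr <;> exact min_le_left _ _

lemma cons_eq (m : ℕ) (p : ℝ × (Fin m → ℝ)) :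
    (MeasurableEquiv.piFinSuccAbove (fun _ : Fin (m + 1) => ℝ) 0).symm p =
      (Fin.cons p.1 p.2 : Fin (m + 1) → ℝ) := by
  rw [← Fin.insertNth_zero']
  rfl

lemma measurable_cons (m : ℕ) :
    Measurable fun p : ℝ × (Fin m → ℝ) => (Fin.cons p.1 p.2 : Fin (m + 1) → ℝ) := by
  simp_rw [← cons_eq]
  exact MeasurableEquiv.measurable _

lemma lintegral_cons (m : ℕ) {f : (Fin (m + 1) → ℝ) → ℝ≥0∞} (hf : Measurable f) :
    ∫⁻ x, f x = ∫⁻ s : ℝ, ∫⁻ y : Fin m → ℝ, f (Fin.cons s y) := by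
  have e := (volume_preserving_piFinSuccAbove (fun _ : Fin (m + 1) => ℝ) 0).symm
  rw [← e.lintegral_comp_emb (MeasurableEquiv.measurableEmbedding _)]
  simp_rw [cons_eq]
  exact lintegral_prod _ (hf.comp (measurable_cons m)).aemeasurable

/-- Prékopa-Leindler. -/
lemma pl_fin {a b : ℝ} (ha : 0 < a) (hb : 0 < b) (hab : a + b = 1) (m : ℕ) :
    ∀ {f g h : (Fin m → ℝ) → ℝ≥0∞}, Measurable f → Measurable g → Measurable h →
    (∀ x y, f x ^ a * g y ^ b ≤ h (a • x + b • y)) →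
    (∫⁻ x, f x) ^ a * (∫⁻ x, g x) ^ b ≤ ∫⁻ x, h x := by
  induction m with
  | zero =>
    intro f g h _ _ _ H
    simp only [lintegral_unique, volume_pi, Measure.pi_univ, Finset.univ_eq_empty,
      Finset.prod_empty, mul_one]
    refine (H _ _).trans_eq ?_
    congr 1
    exact Subsingleton.elim _ _
  | succ m ih =>
    intro f g h hf hg hh H
    have mc : Measurable fun p : ℝ × (Fin m → ℝ) => (Fin.cons p.1 p.2 : Fin (m + 1) → ℝ) :=
      measurable_cons m
    have ms : ∀ s : ℝ, Measurable fun y : Fin m → ℝ => (Fin.cons s y : Fin (m + 1) → ℝ) :=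
      fun s => mc.comp measurable_prodMk_left
    rw [lintegral_cons m hf, lintegral_cons m hg, lintegral_cons m hh]
    refine pl_one ha hb hab (hf.comp mc).lintegral_prod_right' (hg.comp mc).lintegral_prod_right'
      (hh.comp mc).lintegral_prod_right' ?_
    intro s t
    refine ih (hf.comp (ms s)) (hg.comp (ms t)) (hh.comp (ms _)) ?_
    intro x y
    refine (H _ _).trans_eq ?_
    congr 1
    funext i
    refine Fin.cases ?_ (fun j => ?_) i <;> simp

/-- Prékopa's theorem: if `φ(x,y)` is convex on `ℝⁿ × ℝᵐ` and `e^{−φ(x,·)}` is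
integrable for each `x`, then `φ̃(x) = −log ∫_{ℝᵐ} e^{−φ(x,y)} dy` is convex. -/
theorem stmt15 (n m : ℕ) (φ : (Fin n → ℝ) × (Fin m → ℝ) → ℝ)
    (hconv : ConvexOn ℝ Set.univ φ)
    (hint : ∀ x : Fin n → ℝ, Integrable (fun y : Fin m → ℝ => Real.exp (-φ (x, y)))) :
    ConvexOn ℝ Set.univ
      (fun x : Fin n → ℝ => -Real.log (∫ y : Fin m → ℝ, Real.exp (-φ (x, y)))) := by
  have hcont : Continuous φ := by
    rw [← continuousOn_univ]
    exact hconv.continuousOn isOpen_univ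
  have hpos : ∀ x, 0 < ∫ y : Fin m → ℝ, Real.exp (-φ (x, y)) := fun x =>
    integral_exp_pos (hint x)
  have hme : ∀ x, Measurable fun y : Fin m → ℝ => ENNReal.ofReal (Real.exp (-φ (x, y))) :=
    fun x => (Continuous.measurable (by fun_prop)).ennreal_ofReal
  rw [convexOn_iff_forall_pos]
  refine ⟨convex_univ, ?_⟩
  intro x _ y _ a b ha hb hab
  have key := pl_fin ha hb hab m (hme x) (hme y) (hme (a • x + b • y)) (by
    intro u v
    rw [ENNReal.ofReal_rpow_of_pos (Real.exp_pos _), ENNReal.ofReal_rpow_of_pos (Real.exp_pos _),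
      ← ENNReal.ofReal_mul (by positivity), ← Real.exp_mul, ← Real.exp_mul, ← Real.exp_add]
    refine ENNReal.ofReal_le_ofReal (Real.exp_le_exp.2 ?_)
    have := hconv.2 (Set.mem_univ (x, u)) (Set.mem_univ (y, v)) ha.le hb.le hab
    simp only [Prod.smul_mk, Prod.mk_add_mk, smul_eq_mul] at this
    linarith)
  have e : ∀ x, ∫⁻ y : Fin m → ℝ, ENNReal.ofReal (Real.exp (-φ (x, y))) =
      ENNReal.ofReal (∫ y : Fin m → ℝ, Real.exp (-φ (x, y))) := fun x =>
    (ofReal_integral_eq_lintegral_ofReal (hint x) (.of_forall fun _ => (Real.exp_pos _).le)).symm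
  rw [e, e, e, ENNReal.ofReal_rpow_of_pos (hpos _), ENNReal.ofReal_rpow_of_pos (hpos _),
    ← ENNReal.ofReal_mul (Real.rpow_pos_of_pos (hpos _) _).le,
    ENNReal.ofReal_le_ofReal_iff (hpos _).le] at key
  have h1 := Real.rpow_pos_of_pos (hpos x) a
  have h2 := Real.rpow_pos_of_pos (hpos y) b
  have := Real.log_le_log (mul_pos h1 h2) key
  rw [Real.log_mul h1.ne' h2.ne', Real.log_rpow (hpos _), Real.log_rpow (hpos _)] at this
  simp only [smul_eq_mul]
  linarith
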